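/- arXiv:1305.4282 — 2 statements merged into one kernel-verified Lean document; each statement's English description precedes it below -/
import Mathlib

section
/- Let T₁(x,y) = (1−x, y) and T₂(x,y) = (x, 1−y). Then F is T₁-reversible and T₂-reversible: T₁ ∘ F ∘ T₁ = F⁻¹ and T₂ ∘ F ∘ T₂ = F⁻¹ on Q; equivalently, T₁(F(T₁(F(p)))) = p and T₂(F(T₂(F(p)))) = p for every p ∈ Q. -/
open Real Set Filter

noncomputable section

/-- A point in the plane. -/
abbrev Pt : Type := ℝ × ℝ

/-- The unit square `Q = [0,1] × [0,1]`. -/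
def unitSq : Set Pt := Icc (0:ℝ) 1 ×ˢ Icc (0:ℝ) 1

/-- The corners `E₁, E₂, E₃, E₄` of the unit square (cyclically indexed). -/
def Ept : Fin 4 → Pt := ![(0,0), (1,0), (1,1), (0,1)]

/-- The inner points `P₁, P₂, P₃, P₄` (cyclically indexed). -/
def Ppt (s t : ℝ) : Fin 4 → Pt := ![(s,t), (1-t,s), (1-s,1-t), (t,1-s)]

/-- The image points `P₁′, P₂′, P₃′, P₄′` (cyclically indexed). -/
def Ppt' (s t : ℝ) : Fin 4 → Pt := ![(1-s,t), (1-t,1-s), (s,1-t), (t,s)]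

/-- The triangle `𝒜ᵢ = conv {Eᵢ, Eᵢ₊₁, Pᵢ}`. -/
def Apiece (s t : ℝ) (i : Fin 4) : Set Pt :=
  convexHull ℝ {Ept i, Ept (i+1), Ppt s t i}

/-- The triangle `ℬᵢ = conv {Eᵢ, Pᵢ, Pᵢ₋₁}`. -/
def Bpiece (s t : ℝ) (i : Fin 4) : Set Pt :=
  convexHull ℝ {Ept i, Ppt s t i, Ppt s t (i-1)}

/-- The central square `𝒞 = conv {P₁, P₂, P₃, P₄}`. -/
def Cpiece (s t : ℝ) : Set Pt :=
  convexHull ℝ {Ppt s t 0, Ppt s t 1, Ppt s t 2, Ppt s t 3}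

/-- `F : Q → Q` is continuous, affine on each of the nine pieces, fixes the
corners `Eᵢ` and maps `Pᵢ` to `Pᵢ′`. -/
def IsPAMap (s t : ℝ) (F : Pt → Pt) : Prop :=
  MapsTo F unitSq unitSq ∧
  ContinuousOn F unitSq ∧
  (∀ i : Fin 4, ∃ g : Pt →ᵃ[ℝ] Pt, EqOn F g (Apiece s t i)) ∧
  (∀ i : Fin 4, ∃ g : Pt →ᵃ[ℝ] Pt, EqOn F g (Bpiece s t i)) ∧
  (∃ g : Pt →ᵃ[ℝ] Pt, EqOn F g (Cpiece s t)) ∧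
  (∀ i : Fin 4, F (Ept i) = Ept i) ∧
  (∀ i : Fin 4, F (Ppt s t i) = Ppt' s t i)

/-- The reflection `T₁(x,y) = (1-x, y)`. -/
def T1map : Pt → Pt := fun p => (1 - p.1, p.2)

/-- The reflection `T₂(x,y) = (x, 1-y)`. -/
def T2map : Pt → Pt := fun p => (p.1, 1 - p.2)

/-- Signed area of the parallelogram spanned by `b - a` and `c - a`. -/
def cross (a b c : Pt) : ℝ :=
  (b.1 - a.1) * (c.2 - a.2) - (b.2 - a.2) * (c.1 - a.1)

lemma mem_convexHull_triple_of_cross_nonneg {a b c p : Pt} (habc : 0 < cross a b c)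
    (ha : 0 ≤ cross b c p) (hb : 0 ≤ cross c a p) (hc : 0 ≤ cross a b p) :
    p ∈ convexHull ℝ {a, b, c} := by
  have hconv := convex_convexHull ℝ ({a, b, c} : Set Pt)
  have hmem : ∀ v ∈ ({a, b, c} : Set Pt), v ∈ convexHull ℝ ({a, b, c} : Set Pt) :=
    fun v hv => subset_convexHull ℝ _ hv
  have hsum : cross b c p + cross c a p + cross a b p = cross a b c := by
    simp only [cross]; ring
  have key := hconv.sum_mem (t := Finset.univ)
    (w := ![cross b c p / cross a b c, cross c a p / cross a b c, cross a b p / cross a b c])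
    (z := ![a, b, c])
    (by intro i _; fin_cases i <;> simp <;> positivity)
    (by
      simp only [Fin.sum_univ_three, Matrix.cons_val]
      rw [← add_div, ← add_div, hsum, div_self habc.ne'])
    (by intro i _; fin_cases i <;> exact hmem _ (by simp))
  convert key using 1
  simp only [Fin.sum_univ_three, Matrix.cons_val]
  ext
  · simp only [Prod.fst_add, Prod.smul_fst, smul_eq_mul]
    field_simp
    simp only [cross]; ring
  · simp only [Prod.snd_add, Prod.smul_snd, smul_eq_mul]
    field_simp
    simp only [cross]; ring

lemma apply_apply_of_mem_convexHull {H : Pt → Pt} {S S' : Set Pt} {g g' : Pt →ᵃ[ℝ] Pt}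
    (hg : EqOn H g (convexHull ℝ S)) (hg' : EqOn H g' (convexHull ℝ S'))
    (hS : MapsTo H S S') (hinv : ∀ v ∈ S, H (H v) = v) {p : Pt} (hp : p ∈ convexHull ℝ S) :
    H (H p) = p := by
  have hgS : MapsTo g (convexHull ℝ S) (convexHull ℝ S') := by
    rw [mapsTo_iff_image_subset, AffineMap.image_convexHull]
    refine convexHull_mono ?_
    rintro _ ⟨v, hv, rfl⟩
    rw [← hg (subset_convexHull ℝ S hv)]
    exact hS hv
  have hfix : EqOn (g'.comp g) (AffineMap.id ℝ Pt) (convexHull ℝ S) := by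
    refine (AffineMap.eqOn_affineSpan ?_).mono (convexHull_subset_affineSpan S)
    intro v hv
    have hv' := subset_convexHull ℝ S hv
    simpa [← hg hv', ← hg' (hg hv' ▸ hgS hv')] using hinv v hv
  rw [hg hp, hg' (hgS hp)]
  exact hfix hp

/-- The rotation by a quarter turn about the centre of the unit square. -/
def quarterTurn : Pt →ᵃ[ℝ] Pt where
  toFun p := (1 - p.2, p.1)
  linear := (-LinearMap.snd ℝ ℝ ℝ).prod (LinearMap.fst ℝ ℝ ℝ)
  map_vadd' p v := by ext <;> simp; ring

@[simp] lemma quarterTurn_apply (p : Pt) : quarterTurn p = (1 - p.2, p.1) := rfl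

lemma quarterTurn_Ept (i : Fin 4) : quarterTurn (Ept i) = Ept (i + 1) := by
  fin_cases i <;> simp [Ept]

lemma quarterTurn_Ppt (s t : ℝ) (i : Fin 4) : quarterTurn (Ppt s t i) = Ppt s t (i + 1) := by
  fin_cases i <;> simp [Ppt]

lemma quarterTurn_mem_convexHull {S S' : Set Pt} (h : MapsTo quarterTurn S S') {p : Pt}
    (hp : p ∈ convexHull ℝ S) : quarterTurn p ∈ convexHull ℝ S' :=
  convexHull_mono h.image_subset
    (AffineMap.image_convexHull quarterTurn S ▸ mem_image_of_mem _ hp)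

/-- `p` lies in one of the nine pieces. -/
def IsCovered (s t : ℝ) (p : Pt) : Prop :=
  (∃ i, p ∈ Apiece s t i) ∨ (∃ i, p ∈ Bpiece s t i) ∨ p ∈ Cpiece s t

lemma IsCovered.quarterTurn {s t : ℝ} {p : Pt} (h : IsCovered s t p) :
    IsCovered s t (quarterTurn p) := by
  rcases h with ⟨i, h⟩ | ⟨i, h⟩ | h
  · refine .inl ⟨i + 1, quarterTurn_mem_convexHull ?_ h⟩
    rintro v (rfl | rfl | rfl) <;> simp only [quarterTurn_Ept, quarterTurn_Ppt] <;> simp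
  · refine .inr (.inl ⟨i + 1, quarterTurn_mem_convexHull ?_ h⟩)
    rintro v (rfl | rfl | rfl) <;> simp only [quarterTurn_Ept, quarterTurn_Ppt] <;> simp
  · refine .inr (.inr (quarterTurn_mem_convexHull ?_ h))
    rintro v (rfl | rfl | rfl | rfl) <;> simp only [quarterTurn_Ppt] <;> simp

section Covering

variable {a b : ℝ}

lemma cross_Ppt_zero_one (h1 : a ^ 2 + b ^ 2 = 1) (p : Pt) :
    cross (Ppt (a * b) (a ^ 2) 0) (Ppt (a * b) (a ^ 2) 1) p =
      (b - a) * (b * p.2 - a * p.1) := by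
  simp only [cross, Ppt, Matrix.cons_val]
  grind

lemma cross_Ppt_one_two (h1 : a ^ 2 + b ^ 2 = 1) (p : Pt) :
    cross (Ppt (a * b) (a ^ 2) 1) (Ppt (a * b) (a ^ 2) 2) p =
      (b - a) * (b * (1 - p.1) - a * p.2) := by
  simp only [cross, Ppt, Matrix.cons_val]
  grind

lemma cross_Ppt_two_three (h1 : a ^ 2 + b ^ 2 = 1) (p : Pt) :
    cross (Ppt (a * b) (a ^ 2) 2) (Ppt (a * b) (a ^ 2) 3) p =
      (b - a) * (b * (1 - p.2) - a * (1 - p.1)) := by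
  simp only [cross, Ppt, Matrix.cons_val]
  grind

lemma cross_Ppt_three_zero (h1 : a ^ 2 + b ^ 2 = 1) (p : Pt) :
    cross (Ppt (a * b) (a ^ 2) 3) (Ppt (a * b) (a ^ 2) 0) p =
      (b - a) * (b * p.1 - a * (1 - p.2)) := by
  simp only [cross, Ppt, Matrix.cons_val]
  grind

lemma cross_swap (u v p : Pt) : cross v u p = -cross u v p := by
  simp only [cross]; ring

lemma isCovered_of_mem_cornerTriangle (ha : 0 < a) (hab : a < b) (h1 : a ^ 2 + b ^ 2 = 1)
    {p : Pt} (hy : 0 ≤ p.2) (hl : b * p.2 - a * p.1 ≤ 0)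
    (hr : 0 ≤ b * (1 - p.1) - a * p.2) : IsCovered (a * b) (a ^ 2) p := by
  rcases le_total (cross (Ept 1) (Ppt (a * b) (a ^ 2) 0) p) 0 with h | h
  · refine .inr (.inl ⟨1, mem_convexHull_triple_of_cross_nonneg ?_ ?_ ?_ ?_⟩)
    · have key : cross (Ept 1) (Ppt (a * b) (a ^ 2) 1) (Ppt (a * b) (a ^ 2) (1 - 1)) =
          a * (b - a) := by
        simp only [cross, Ept, Ppt, sub_self, Matrix.cons_val]
        grind
      rw [key]
      exact mul_pos ha (sub_pos.2 hab)
    · rw [sub_self, cross_swap, cross_Ppt_zero_one h1]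
      exact neg_nonneg.2 (mul_nonpos_of_nonneg_of_nonpos (sub_pos.2 hab).le hl)
    · rw [sub_self, cross_swap]
      exact neg_nonneg.2 h
    · have key : cross (Ept 1) (Ppt (a * b) (a ^ 2) 1) p =
          a * (b * (1 - p.1) - a * p.2) := by
        simp only [cross, Ept, Ppt, Matrix.cons_val]
        ring
      rw [key]
      exact mul_nonneg ha.le hr
  · refine .inl ⟨0, mem_convexHull_triple_of_cross_nonneg ?_ ?_ ?_ ?_⟩
    · simp [cross, Ept, Ppt, ha]
    · simpa using h
    · simp only [cross, Ept, Ppt, Matrix.cons_val]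
      nlinarith
    · simpa [cross, Ept] using hy

lemma isCovered_of_mem_centralSquare (hab : a < b) (h1 : a ^ 2 + b ^ 2 = 1)
    {p : Pt} (h₁ : 0 ≤ b * p.2 - a * p.1) (h₂ : 0 ≤ b * (1 - p.1) - a * p.2)
    (h₃ : 0 ≤ b * (1 - p.2) - a * (1 - p.1)) (h₄ : 0 ≤ b * p.1 - a * (1 - p.2)) :
    IsCovered (a * b) (a ^ 2) p := by
  refine .inr (.inr ?_)
  have hd := sub_pos.2 hab
  have hdd := mul_pos hd hd
  rcases le_total 0 (cross (Ppt (a * b) (a ^ 2) 2) (Ppt (a * b) (a ^ 2) 0) p) with h | h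
  · refine convexHull_mono (s := {Ppt (a * b) (a ^ 2) 0, Ppt (a * b) (a ^ 2) 1,
      Ppt (a * b) (a ^ 2) 2}) (by rintro v (rfl | rfl | rfl) <;> simp)
      (mem_convexHull_triple_of_cross_nonneg ?_ ?_ h ?_)
    · rw [cross_Ppt_zero_one h1]
      simp only [Ppt, Matrix.cons_val]
      grind
    · rw [cross_Ppt_one_two h1]
      exact mul_nonneg hd.le h₂
    · rw [cross_Ppt_zero_one h1]
      exact mul_nonneg hd.le h₁
  · refine convexHull_mono (s := {Ppt (a * b) (a ^ 2) 2, Ppt (a * b) (a ^ 2) 3,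
      Ppt (a * b) (a ^ 2) 0}) (by rintro v (rfl | rfl | rfl) <;> simp)
      (mem_convexHull_triple_of_cross_nonneg ?_ ?_ ?_ ?_)
    · rw [cross_Ppt_two_three h1]
      simp only [Ppt, Matrix.cons_val]
      grind
    · rw [cross_Ppt_three_zero h1]
      exact mul_nonneg hd.le h₄
    · rw [cross_swap]
      exact neg_nonneg.2 h
    · rw [cross_Ppt_two_three h1]
      exact mul_nonneg hd.le h₃

lemma isCovered_of_mem_unitSq (ha : 0 < a) (hab : a < b) (h1 : a ^ 2 + b ^ 2 = 1)
    {p : Pt} (hp : p ∈ unitSq) : IsCovered (a * b) (a ^ 2) p := by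
  obtain ⟨x, y⟩ := p
  simp only [unitSq, mem_prod, mem_Icc] at hp
  obtain ⟨⟨hx0, hx1⟩, hy0, hy1⟩ := hp
  have corner {q : Pt} := isCovered_of_mem_cornerTriangle (p := q) ha hab h1
  rcases le_total 0 (b * y - a * x) with l₁ | l₁ <;>
  rcases le_total 0 (b * (1 - x) - a * y) with l₂ | l₂ <;>
  rcases le_total 0 (b * (1 - y) - a * (1 - x)) with l₃ | l₃ <;>
  rcases le_total 0 (b * x - a * (1 - y)) with l₄ | l₄
  all_goals first
    | exact isCovered_of_mem_centralSquare hab h1 l₁ l₂ l₃ l₄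
    | exact corner hy0 l₁ l₂
    | simpa using
        (corner (q := (y, 1 - x)) (by simpa using hx1) l₂ (by simpa using l₃)).quarterTurn
    | simpa using (corner (q := (1 - x, 1 - y)) (by simpa using hy1) l₃
        (by simpa using l₄)).quarterTurn.quarterTurn
    | simpa using (corner (q := (1 - y, x)) hx0 (by simpa using l₄)
        (by simpa using l₁)).quarterTurn.quarterTurn.quarterTurn
    | (exfalso; linarith)

end Covering

lemma apply_apply_eq_self {s t : ℝ} {F : Pt → Pt} (hF : IsPAMap s t F) (T : Pt →ᵃ[ℝ] Pt)
    (k : Fin 4) (hE : ∀ i, T (Ept i) = Ept (k + 1 - i))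
    (hP : ∀ i, T (Ppt' s t i) = Ppt s t (k - i)) {p : Pt} (hp : IsCovered s t p) :
    T (F (T (F p))) = p := by
  obtain ⟨-, -, hA, hB, hC, hFE, hFP⟩ := hF
  have hHE (i) : (T ∘ F) (Ept i) = Ept (k + 1 - i) := by simp [hFE, hE]
  have hHP (i) : (T ∘ F) (Ppt s t i) = Ppt s t (k - i) := by simp [hFP, hP]
  have lift {S : Set Pt} : (∃ g : Pt →ᵃ[ℝ] Pt, EqOn F g S) →
      ∃ g : Pt →ᵃ[ℝ] Pt, EqOn (T ∘ F) g S := fun ⟨g, hg⟩ =>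
    ⟨T.comp g, fun x hx => by simp [hg hx]⟩
  have hEE (i) : (T ∘ F) ((T ∘ F) (Ept i)) = Ept i := by
    rw [hHE, hHE, sub_sub_cancel]
  have hPP (i) : (T ∘ F) ((T ∘ F) (Ppt s t i)) = Ppt s t i := by
    rw [hHP, hHP, sub_sub_cancel]
  rcases hp with ⟨i, h⟩ | ⟨i, h⟩ | h
  · obtain ⟨g, hg⟩ := lift (hA i)
    obtain ⟨g', hg'⟩ := lift (hA (k - i))
    refine apply_apply_of_mem_convexHull hg hg' ?_ ?_ h
    · rintro v (rfl | rfl | rfl)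
      · rw [hHE, sub_add_eq_add_sub]; simp
      · rw [hHE, add_sub_add_right_eq_sub]; simp
      · rw [hHP]; simp
    · rintro v (rfl | rfl | rfl)
      exacts [hEE _, hEE _, hPP _]
  · obtain ⟨g, hg⟩ := lift (hB i)
    obtain ⟨g', hg'⟩ := lift (hB (k + 1 - i))
    refine apply_apply_of_mem_convexHull hg hg' ?_ ?_ h
    · rintro v (rfl | rfl | rfl)
      · rw [hHE]; simp
      · rw [hHP, show k + 1 - i - 1 = k - i by abel]; simp
      · rw [hHP, show k - (i - 1) = k + 1 - i by abel]; simp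
    · rintro v (rfl | rfl | rfl)
      exacts [hEE _, hPP _, hPP _]
  · obtain ⟨g, hg⟩ := lift hC
    refine apply_apply_of_mem_convexHull hg hg ?_ ?_ h
    · have hmem (j : Fin 4) : Ppt s t j ∈
          ({Ppt s t 0, Ppt s t 1, Ppt s t 2, Ppt s t 3} : Set Pt) := by
        fin_cases j <;> simp
      rintro v (rfl | rfl | rfl | rfl) <;> rw [hHP] <;> exact hmem _
    · rintro v (rfl | rfl | rfl | rfl) <;> exact hPP _

/-- `T1map` as an affine map. -/
def T1affine : Pt →ᵃ[ℝ] Pt where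
  toFun := T1map
  linear := (-LinearMap.fst ℝ ℝ ℝ).prod (LinearMap.snd ℝ ℝ ℝ)
  map_vadd' p v := by ext <;> simp [T1map]; ring

/-- `T2map` as an affine map. -/
def T2affine : Pt →ᵃ[ℝ] Pt where
  toFun := T2map
  linear := (LinearMap.fst ℝ ℝ ℝ).prod (-LinearMap.snd ℝ ℝ ℝ)
  map_vadd' p v := by ext <;> simp [T2map]; ring

lemma T1affine_apply (p : Pt) : T1affine p = (1 - p.1, p.2) := rfl

lemma T2affine_apply (p : Pt) : T2affine p = (p.1, 1 - p.2) := rfl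

/-- `F` is `T₁`- and `T₂`-reversible: `T₁ ∘ F ∘ T₁ = F⁻¹` and
`T₂ ∘ F ∘ T₂ = F⁻¹` on `Q`, i.e. `T₁ (F (T₁ (F p))) = p` and `T₂ (F (T₂ (F p))) = p`
for every `p ∈ Q`. -/
theorem square_map_T_reversible (θ : ℝ) (hθ : θ ∈ Ioo 0 (π/4))
    (t s : ℝ) (ht : t = sin θ ^ 2) (hs : s = sin θ * cos θ)
    (F : Pt → Pt) (hF : IsPAMap s t F) :
    ∀ p ∈ unitSq, T1map (F (T1map (F p))) = p ∧ T2map (F (T2map (F p))) = p := by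
  intro p hp
  have hθ0 : 0 < sin θ := sin_pos_of_pos_of_lt_pi hθ.1 (by linarith [hθ.2, pi_pos])
  have hsc : sin θ < cos θ := by
    rw [← cos_pi_div_two_sub]
    exact cos_lt_cos_of_nonneg_of_le_pi_div_two hθ.1.le (by linarith [hθ.1])
      (by linarith [hθ.2])
  subst ht hs
  have hcov := isCovered_of_mem_unitSq hθ0 hsc (sin_sq_add_cos_sq θ) hp
  refine ⟨apply_apply_eq_self hF T1affine 0 ?_ ?_ hcov,
    apply_apply_eq_self hF T2affine 2 ?_ ?_ hcov⟩
  all_goals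
    intro i
    fin_cases i <;> simp [T1affine_apply, T2affine_apply, Ept, Ppt, Ppt']
end
end

section
/- For every integer K ≥ 3 there exists θ ∈ (0, π/4) such that, writing F = F_θ and R(x,y) = (1−y, x) (the rotation by π/2 about (1/2,1/2)), for every integer N ≥ 0 there exists a point X ∈ [E₁, P₄] with X ≠ E₁ satisfying: F^n(X) ∈ ℬ₁ for 0 ≤ n < K; F^K(X) ∈ [E₁, P₁]; F^n(X) ∈ 𝒜₁ for K ≤ n < K + N; and F^{K+N}(X) = R(X). In particular F^{4(K+N)}(X) = X, so X is a periodic point of F of period dividing 4(K+N). -/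
open Real Set Filter

noncomputable section

/-- `t = sin²θ`. -/
def tof (θ : ℝ) : ℝ := sin θ ^ 2

/-- `s = sinθ·cosθ`. -/
def sof (θ : ℝ) : ℝ := sin θ * cos θ

/-- The rotation by `π/2` about `Z = (1/2, 1/2)`. -/
def Rmap : Pt → Pt := fun p => (1 - p.2, p.1)

/-! ### The second-order recurrence `w (n + 2) = T * w (n + 1) - w n` -/

/-- The solution of `w (n + 2) = T * w (n + 1) - w n` with `w 0 = 0`, `w 1 = 1`. -/
def lucasSeq (T : ℝ) : ℕ → ℝ
  | 0 => 0
  | 1 => 1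
  | n + 2 => T * lucasSeq T (n + 1) - lucasSeq T n

lemma lucasSeq_add_two (T : ℝ) (n : ℕ) :
    lucasSeq T (n + 2) = T * lucasSeq T (n + 1) - lucasSeq T n := by
  rw [lucasSeq]

lemma lucasSeq_docagne (T : ℝ) (n j : ℕ) :
    lucasSeq T (n + 1) * lucasSeq T (n + j) - lucasSeq T n * lucasSeq T (n + j + 1)
      = lucasSeq T j := by
  induction n with
  | zero => simp [lucasSeq]
  | succ n ih =>
    have h₁ := lucasSeq_add_two T n
    have h₂ := lucasSeq_add_two T (n + j)
    rw [show n + 1 + j = n + j + 1 by ring, h₁, h₂, ← ih]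
    ring

lemma lucasSeq_two (n : ℕ) : lucasSeq 2 n = n := by
  have h : lucasSeq 2 n = n ∧ lucasSeq 2 (n + 1) = n + 1 := by
    induction n with
    | zero => simp [lucasSeq]
    | succ n ih =>
      refine ⟨by simpa using ih.2, ?_⟩
      rw [lucasSeq_add_two, ih.1, ih.2]
      push_cast
      ring
  exact h.1

lemma lucasSeq_nonneg_and_step {T : ℝ} (hT : 2 ≤ T) (n : ℕ) :
    0 ≤ lucasSeq T n ∧ lucasSeq T n + 1 ≤ lucasSeq T (n + 1) := by
  induction n with
  | zero => simp [lucasSeq]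
  | succ n ih =>
    have h := lucasSeq_add_two T n
    refine ⟨by linarith, ?_⟩
    rw [h]
    nlinarith

lemma lucasSeq_nonneg {T : ℝ} (hT : 2 ≤ T) (n : ℕ) : 0 ≤ lucasSeq T n :=
  (lucasSeq_nonneg_and_step hT n).1

lemma lucasSeq_succ_pos {T : ℝ} (hT : 2 ≤ T) (n : ℕ) : 0 < lucasSeq T (n + 1) := by
  have h := lucasSeq_nonneg_and_step hT n
  linarith

lemma lucasSeq_sub_mono {T : ℝ} (hT : 2 ≤ T) :
    Monotone fun n => lucasSeq T (n + 1) - lucasSeq T n := by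
  refine monotone_nat_of_le_succ fun n => ?_
  have h := lucasSeq_succ_pos hT n
  simp only [lucasSeq_add_two T n]
  nlinarith

lemma lucasSeq_superadditive {T : ℝ} (hT : 2 ≤ T) (m n : ℕ) :
    lucasSeq T m + lucasSeq T n ≤ lucasSeq T (m + n) := by
  induction n with
  | zero => simp [lucasSeq]
  | succ n ih =>
    have h := lucasSeq_sub_mono hT (show n ≤ m + n by omega)
    simp only [← add_assoc] at h ⊢
    linarith

lemma continuous_lucasSeq (n : ℕ) : Continuous fun T => lucasSeq T n := by
  induction n using Nat.twoStepInduction with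
  | zero => simpa [lucasSeq] using continuous_const
  | one => simpa [lucasSeq] using continuous_const
  | more n ih₁ ih₂ =>
    simp only [lucasSeq_add_two]
    exact (continuous_id.mul ih₂).sub ih₁

/-! ### The choice of the parameter -/

/-- The trace of the linear part of `F` on `ℬ₁`, in terms of `r = tan θ`. -/
def traceB (r : ℝ) : ℝ := 2 + (1 - r) ^ 3 / (r * (1 + r ^ 2))

lemma exists_slope_lucasSeq {K : ℕ} (hK : 3 ≤ K) :
    ∃ r ∈ Ioo (0 : ℝ) 1, r * (1 + r) / (1 + r ^ 2) * lucasSeq (traceB r) K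
      = lucasSeq (traceB r) (K - 1) := by
  obtain ⟨k, rfl⟩ : ∃ k, K = k + 3 := ⟨K - 3, by omega⟩
  let G : ℝ → ℝ := fun r =>
    r * (1 + r) / (1 + r ^ 2) * lucasSeq (traceB r) (k + 3) - lucasSeq (traceB r) (k + 2)
  have hcT : ContinuousOn traceB (Icc (1 / 4) 1) := by
    refine continuousOn_const.add (ContinuousOn.div (by fun_prop) (by fun_prop) fun r hr => ?_)
    have : 0 < r := by linarith [hr.1]
    positivity
  have hcG : ContinuousOn G (Icc (1 / 4) 1) := by
    refine ContinuousOn.sub (ContinuousOn.mul ?_ ((continuous_lucasSeq _).comp_continuousOn' hcT))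
      ((continuous_lucasSeq _).comp_continuousOn' hcT)
    refine ContinuousOn.div (by fun_prop) (by fun_prop) fun r _ => ?_
    positivity
  have hleft : G (1 / 4) < 0 := by
    have hT : traceB (1 / 4) = 61 / 17 := by norm_num [traceB]
    have h₀ := lucasSeq_nonneg (T := 61 / 17) (by norm_num) k
    have h₁ := lucasSeq_succ_pos (T := 61 / 17) (by norm_num) k
    simp only [G, hT, lucasSeq_add_two _ (k + 1), lucasSeq_add_two _ k]
    norm_num
    linarith
  have hright : 0 < G 1 := by
    have hT : traceB 1 = 2 := by norm_num [traceB]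
    simp only [G, hT, lucasSeq_two]
    push_cast
    linarith
  obtain ⟨r, hr, hGr⟩ := intermediate_value_Ioo (by norm_num) hcG ⟨hleft, hright⟩
  exact ⟨r, ⟨by linarith [hr.1], hr.2⟩, sub_eq_zero.1 hGr⟩

lemma tof_arctan (r : ℝ) : tof (arctan r) = r ^ 2 / (1 + r ^ 2) := by
  rw [tof, sin_arctan, div_pow, sq_sqrt (by positivity)]

lemma sof_arctan (r : ℝ) : sof (arctan r) = r / (1 + r ^ 2) := by
  rw [sof, sin_arctan, cos_arctan, div_mul_div_comm, mul_self_sqrt (by positivity), mul_one]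

/-! ### Affine pieces and the rotational symmetry -/

lemma mem_convexHull_triple {a b c x : Pt} :
    x ∈ convexHull ℝ {a, b, c} ↔ ∃ α β γ : ℝ, 0 ≤ α ∧ 0 ≤ β ∧ 0 ≤ γ ∧ α + β + γ = 1 ∧
      α • a + β • b + γ • c = x := by
  constructor
  · intro hx
    rw [convexHull_insert (by simp), convexHull_pair, mem_convexJoin] at hx
    obtain ⟨a', ha', y, ⟨p, q, hp, hq, hpq, rfl⟩, ⟨u, v, hu, hv, huv, rfl⟩⟩ := hx
    rw [mem_singleton_iff] at ha'
    subst ha'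
    refine ⟨u, v * p, v * q, hu, by positivity, by positivity, ?_, ?_⟩
    · rw [add_assoc, ← mul_add, hpq, mul_one, huv]
    · rw [smul_add, smul_smul, smul_smul, add_assoc]
  · rintro ⟨α, β, γ, hα, hβ, hγ, hsum, rfl⟩
    have hs := subset_convexHull ℝ ({a, b, c} : Set Pt)
    have h := (convex_convexHull ℝ ({a, b, c} : Set Pt)).sum_mem (t := Finset.univ)
      (w := ![α, β, γ]) (z := ![a, b, c])
      (by intro i _; fin_cases i <;> simpa) (by simpa [Fin.sum_univ_three] using hsum)
      (by intro i _; fin_cases i <;> exact hs (by simp))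
    simpa [Fin.sum_univ_three] using h

lemma affine_combination_triple (g : Pt →ᵃ[ℝ] Pt) (a b c : Pt) {α β γ : ℝ}
    (h : α + β + γ = 1) :
    g (α • a + β • b + γ • c) = α • g a + β • g b + γ • g c := by
  have hg : ∀ p, g p = g.linear p + g 0 := fun p => by
    simpa using g.map_vadd 0 p
  rw [hg, hg a, hg b, hg c, map_add, map_add, map_smul, map_smul, map_smul]
  have h0 : g 0 = α • g 0 + β • g 0 + γ • g 0 := by rw [← add_smul, ← add_smul, h, one_smul]
  nth_rw 1 [h0]
  simp only [smul_add]
  abel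

lemma eqOn_combination_triple {F : Pt → Pt} {g : Pt →ᵃ[ℝ] Pt} {a b c : Pt}
    (hg : EqOn F g (convexHull ℝ {a, b, c})) {α β γ : ℝ} (hα : 0 ≤ α) (hβ : 0 ≤ β)
    (hγ : 0 ≤ γ) (h : α + β + γ = 1) :
    F (α • a + β • b + γ • c) = α • F a + β • F b + γ • F c := by
  have hs := subset_convexHull ℝ ({a, b, c} : Set Pt)
  rw [hg (mem_convexHull_triple.2 ⟨α, β, γ, hα, hβ, hγ, h, rfl⟩),
    affine_combination_triple g _ _ _ h,
    hg (hs (by simp)), hg (hs (by simp)), hg (hs (by simp))]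

namespace IsPAMap

variable {s t : ℝ} {F : Pt → Pt}

lemma apply_Apiece (hF : IsPAMap s t F) (i : Fin 4) {α β γ : ℝ} (hα : 0 ≤ α) (hβ : 0 ≤ β)
    (hγ : 0 ≤ γ) (h : α + β + γ = 1) :
    F (α • Ept i + β • Ept (i + 1) + γ • Ppt s t i)
      = α • Ept i + β • Ept (i + 1) + γ • Ppt' s t i := by
  obtain ⟨-, -, hA, -, -, hE, hP⟩ := hF
  obtain ⟨g, hg⟩ := hA i
  rw [eqOn_combination_triple hg hα hβ hγ h, hE, hE, hP]

lemma apply_Bpiece (hF : IsPAMap s t F) (i : Fin 4) {α β γ : ℝ} (hα : 0 ≤ α) (hβ : 0 ≤ β)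
    (hγ : 0 ≤ γ) (h : α + β + γ = 1) :
    F (α • Ept i + β • Ppt s t i + γ • Ppt s t (i - 1))
      = α • Ept i + β • Ppt' s t i + γ • Ppt' s t (i - 1) := by
  obtain ⟨-, -, -, hB, -, hE, hP⟩ := hF
  obtain ⟨g, hg⟩ := hB i
  rw [eqOn_combination_triple hg hα hβ hγ h, hE, hP, hP]

end IsPAMap

lemma Rmap_combination (a b c : Pt) {α β γ : ℝ} (h : α + β + γ = 1) :
    Rmap (α • a + β • b + γ • c) = α • Rmap a + β • Rmap b + γ • Rmap c := by
  ext
  · simp only [Rmap, Prod.fst_add, Prod.snd_add, Prod.smul_fst, Prod.smul_snd, smul_eq_mul]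
    linear_combination -h
  · simp [Rmap]

lemma Rmap_Ept (i : Fin 4) : Rmap (Ept i) = Ept (i + 1) := by
  fin_cases i <;> simp [Rmap, Ept]

lemma Rmap_Ppt (s t : ℝ) (i : Fin 4) : Rmap (Ppt s t i) = Ppt s t (i + 1) := by
  fin_cases i <;> simp [Rmap, Ppt]

lemma Rmap_Ppt' (s t : ℝ) (i : Fin 4) : Rmap (Ppt' s t i) = Ppt' s t (i + 1) := by
  fin_cases i <;> simp [Rmap, Ppt']

lemma Rmap_iterate_four (p : Pt) : Rmap^[4] p = p := by
  ext <;> simp [Rmap]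

namespace IsPAMap

variable {s t : ℝ} {F : Pt → Pt}

lemma apply_Rmap (hF : IsPAMap s t F) {i : Fin 4} {p : Pt}
    (hp : p ∈ Apiece s t i ∪ Bpiece s t i) :
    F (Rmap p) = Rmap (F p) ∧ Rmap p ∈ Apiece s t (i + 1) ∪ Bpiece s t (i + 1) := by
  have hi : i - 1 + 1 = i + 1 - 1 := by lia
  rcases hp with hp | hp <;> obtain ⟨α, β, γ, hα, hβ, hγ, h, rfl⟩ := mem_convexHull_triple.1 hp
  · rw [hF.apply_Apiece i hα hβ hγ h, Rmap_combination _ _ _ h, Rmap_combination _ _ _ h,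
      Rmap_Ept, Rmap_Ept, Rmap_Ppt, Rmap_Ppt', hF.apply_Apiece _ hα hβ hγ h]
    exact ⟨rfl, Or.inl (mem_convexHull_triple.2 ⟨α, β, γ, hα, hβ, hγ, h, rfl⟩)⟩
  · rw [hF.apply_Bpiece i hα hβ hγ h, Rmap_combination _ _ _ h, Rmap_combination _ _ _ h,
      Rmap_Ept, Rmap_Ppt, Rmap_Ppt, Rmap_Ppt', Rmap_Ppt', hi, hF.apply_Bpiece _ hα hβ hγ h]
    exact ⟨rfl, Or.inr (mem_convexHull_triple.2 ⟨α, β, γ, hα, hβ, hγ, h, rfl⟩)⟩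

lemma apply_Rmap_iterate (hF : IsPAMap s t F) (j : ℕ) {i : Fin 4} {p : Pt}
    (hp : p ∈ Apiece s t i ∪ Bpiece s t i) : F (Rmap^[j] p) = Rmap^[j] (F p) := by
  induction j generalizing i p with
  | zero => rfl
  | succ j ih =>
    have h := hF.apply_Rmap hp
    rw [Function.iterate_succ_apply, ih h.2, h.1, Function.iterate_succ_apply]

lemma iterate_Rmap_iterate (hF : IsPAMap s t F) (j : ℕ) {i : Fin 4} {p : Pt} {n : ℕ}
    (hp : ∀ m < n, F^[m] p ∈ Apiece s t i ∪ Bpiece s t i) :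
    F^[n] (Rmap^[j] p) = Rmap^[j] (F^[n] p) := by
  induction n with
  | zero => rfl
  | succ n ih =>
    rw [Function.iterate_succ_apply', ih fun m hm => hp m (by omega),
      hF.apply_Rmap_iterate j (hp n (by omega)), Function.iterate_succ_apply']

lemma iterate_four_mul (hF : IsPAMap s t F) {i : Fin 4} {p : Pt} {n : ℕ}
    (hp : ∀ m < n, F^[m] p ∈ Apiece s t i ∪ Bpiece s t i) (hn : F^[n] p = Rmap p) :
    F^[4 * n] p = p := by
  have h : ∀ j, F^[j * n] p = Rmap^[j] p := fun j => by
    induction j with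
    | zero => simp
    | succ j ih =>
      rw [show (j + 1) * n = n + j * n by ring, Function.iterate_add_apply, ih,
        hF.iterate_Rmap_iterate j hp, hn, Function.iterate_succ_apply]
  rw [h, Rmap_iterate_four]

end IsPAMap

/-! ### The orbit through `ℬ₁` and `𝒜₁` -/

namespace IsPAMap

variable {s t : ℝ} {F : Pt → Pt}

lemma apply_cone_B (hF : IsPAMap s t F) {β γ : ℝ} (hβ : 0 ≤ β) (hγ : 0 ≤ γ) (h : β + γ ≤ 1) :
    β • Ppt s t 0 + γ • Ppt s t 3 ∈ Bpiece s t 0 ∧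
      F (β • Ppt s t 0 + γ • Ppt s t 3) = β • Ppt' s t 0 + γ • Ppt' s t 3 := by
  have hα : 0 ≤ 1 - β - γ := by linarith
  have hsum : 1 - β - γ + β + γ = 1 := by ring
  have hE : Ept 0 = 0 := rfl
  refine ⟨mem_convexHull_triple.2 ⟨_, β, γ, hα, hβ, hγ, hsum, ?_⟩, ?_⟩
  · rw [hE, smul_zero, zero_add]
    rfl
  · have := hF.apply_Bpiece 0 hα hβ hγ hsum
    rw [hE, smul_zero, zero_add, zero_add] at this
    exact this

lemma apply_cone_A (hF : IsPAMap s t F) {β γ : ℝ} (hβ : 0 ≤ β) (hγ : 0 ≤ γ) (h : β + γ ≤ 1) :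
    β • Ept 1 + γ • Ppt s t 0 ∈ Apiece s t 0 ∧
      F (β • Ept 1 + γ • Ppt s t 0) = β • Ept 1 + γ • Ppt' s t 0 := by
  have hα : 0 ≤ 1 - β - γ := by linarith
  have hsum : 1 - β - γ + β + γ = 1 := by ring
  have hE : Ept 0 = 0 := rfl
  refine ⟨mem_convexHull_triple.2 ⟨_, β, γ, hα, hβ, hγ, hsum, ?_⟩, ?_⟩
  · rw [hE, smul_zero, zero_add]
    rfl
  · have := hF.apply_Apiece 0 hα hβ hγ hsum
    rw [hE, smul_zero, zero_add, zero_add] at this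
    exact this

lemma iterate_A (hF : IsPAMap s t F) (hs : 2 * s ≤ 1) {l : ℝ} (hl : 0 ≤ l) {N : ℕ}
    (hN : N * (1 - 2 * s) * l + l ≤ 1) {m : ℕ} (hm : m ≤ N) :
    (m * (1 - 2 * s) * l) • Ept 1 + l • Ppt s t 0 ∈ Apiece s t 0 ∧
      F^[m] (l • Ppt s t 0) = (m * (1 - 2 * s) * l) • Ept 1 + l • Ppt s t 0 := by
  have hc : 0 ≤ 1 - 2 * s := by linarith
  have key : ∀ m : ℕ, m ≤ N → 0 ≤ m * (1 - 2 * s) * l ∧ m * (1 - 2 * s) * l + l ≤ 1 := by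
    intro m hm
    have : (m : ℝ) ≤ N := by exact_mod_cast hm
    refine ⟨by positivity, le_trans ?_ hN⟩
    gcongr
  refine ⟨(hF.apply_cone_A (key m hm).1 hl (key m hm).2).1, ?_⟩
  induction m with
  | zero => simp
  | succ m ih =>
    have hk := key m (by omega)
    rw [Function.iterate_succ_apply', ih (by omega), (hF.apply_cone_A hk.1 hl hk.2).2]
    ext
    · simp [Ept, Ppt, Ppt']
      ring
    · simp [Ept, Ppt, Ppt']

/-- If `F` acts on the basis `P₁, P₄` by a matrix whose entries are ratios of terms of the
sequence `w = lucasSeq T`, then the orbit of `l • P₄` runs through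
`(l / w K) • (w n • P₁ + w (K - n) • P₄)`. -/
lemma iterate_B (hF : IsPAMap s t F) {T : ℝ} (hT : 2 ≤ T) {K : ℕ} (hK : 0 < K)
    (h₁ : lucasSeq T K • Ppt' s t 0
      = lucasSeq T (K + 1) • Ppt s t 0 - Ppt s t 3)
    (h₄ : lucasSeq T K • Ppt' s t 3 = Ppt s t 0 + lucasSeq T (K - 1) • Ppt s t 3)
    {l : ℝ} (hl : 0 ≤ l) (hl₁ : l ≤ 1) {n : ℕ} (hn : n ≤ K) :
    F^[n] (l • Ppt s t 3) ∈ Bpiece s t 0 ∧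
      F^[n] (l • Ppt s t 3) = (l / lucasSeq T K * lucasSeq T n) • Ppt s t 0
        + (l / lucasSeq T K * lucasSeq T (K - n)) • Ppt s t 3 := by
  obtain ⟨k, rfl⟩ : ∃ k, K = k + 1 := ⟨K - 1, by omega⟩
  have hw := lucasSeq_succ_pos hT k
  set W := lucasSeq T (k + 1) with hW
  have key : ∀ n ≤ k + 1, 0 ≤ l / W * lucasSeq T n ∧ 0 ≤ l / W * lucasSeq T (k + 1 - n) ∧
      l / W * lucasSeq T n + l / W * lucasSeq T (k + 1 - n) ≤ 1 := by
    intro n hn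
    have h₀ := lucasSeq_nonneg hT n
    have h₀' := lucasSeq_nonneg hT (k + 1 - n)
    have hsup := lucasSeq_superadditive hT n (k + 1 - n)
    rw [show n + (k + 1 - n) = k + 1 by omega, ← hW] at hsup
    refine ⟨by positivity, by positivity, ?_⟩
    rw [← mul_add, div_mul_eq_mul_div, div_le_one hw]
    nlinarith
  have horb : F^[n] (l • Ppt s t 3) = (l / W * lucasSeq T n) • Ppt s t 0
      + (l / W * lucasSeq T (k + 1 - n)) • Ppt s t 3 := by
    induction n with
    | zero =>
      rw [Nat.sub_zero, ← hW, div_mul_cancel₀ _ hw.ne']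
      simp [lucasSeq]
    | succ n ih =>
      obtain ⟨m, rfl⟩ : ∃ m, k = n + m := ⟨k - n, by omega⟩
      have hk := key n (by omega)
      rw [Function.iterate_succ_apply', ih (by omega),
        (hF.apply_cone_B hk.1 hk.2.1 hk.2.2).2]
      have d₁ := lucasSeq_docagne T n (m + 1)
      have d₂ := lucasSeq_docagne T m n
      rw [show n + m + 1 - n = m + 1 by omega, show n + m + 1 - (n + 1) = m by omega]
      rw [← add_assoc, ← hW] at d₁
      rw [add_comm m n, ← hW] at d₂
      rw [show n + m + 1 - 1 = n + m by omega] at h₄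
      have e₁ : Ppt' s t 0 = W⁻¹ • (lucasSeq T (n + m + 1 + 1) • Ppt s t 0 - Ppt s t 3) := by
        rw [← h₁, inv_smul_smul₀ hw.ne']
      have e₄ : Ppt' s t 3 = W⁻¹ • (Ppt s t 0 + lucasSeq T (n + m) • Ppt s t 3) := by
        rw [← h₄, inv_smul_smul₀ hw.ne']
      rw [e₁, e₄]
      match_scalars
      · field_simp
        linear_combination -l * d₁
      · field_simp
        linear_combination l * d₂
  rw [horb]
  have hk := key n hn
  exact ⟨(hF.apply_cone_B hk.1 hk.2.1 hk.2.2).1, rfl⟩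

end IsPAMap

/-- At a slope solving the equation of `exists_slope_lucasSeq`, the linear part of `F` on `ℬ₁` has
the form required by `IsPAMap.iterate_B`. -/
lemma lucasSeq_smul_Ppt' {r : ℝ} (hr : r ∈ Ioo (0 : ℝ) 1) {K : ℕ} (hK : 0 < K)
    (hT : 2 ≤ traceB r)
    (h : r * (1 + r) / (1 + r ^ 2) * lucasSeq (traceB r) K = lucasSeq (traceB r) (K - 1)) :
    let s := r / (1 + r ^ 2)
    let t := r ^ 2 / (1 + r ^ 2)
    lucasSeq (traceB r) K • Ppt' s t 0 = lucasSeq (traceB r) (K + 1) • Ppt s t 0 - Ppt s t 3 ∧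
      lucasSeq (traceB r) K • Ppt' s t 3
        = Ppt s t 0 + lucasSeq (traceB r) (K - 1) • Ppt s t 3 := by
  intro s t
  obtain ⟨hr₀, hr₁⟩ := hr
  obtain ⟨k, rfl⟩ : ∃ k, K = k + 1 := ⟨K - 1, by omega⟩
  have hw := lucasSeq_succ_pos hT k
  have hdoc := lucasSeq_docagne (traceB r) k 1
  have hrec := lucasSeq_add_two (traceB r) k
  rw [Nat.add_sub_cancel] at h ⊢
  rw [show lucasSeq (traceB r) 1 = 1 from rfl] at hdoc
  set W := lucasSeq (traceB r) (k + 1)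
  have hnext : lucasSeq (traceB r) (k + 2) = (1 - r + 2 * r ^ 2) / (r * (1 + r ^ 2)) * W := by
    rw [hrec, ← h, traceB]
    field_simp
    ring
  have hone : r * (1 - r) / (1 + r ^ 2) * W = 1 := by
    have hr' : 0 ≤ r * (1 - r) / (1 + r ^ 2) * W := by
      have : 0 < 1 - r := by linarith
      positivity
    have hsq : (r * (1 - r) / (1 + r ^ 2) * W) ^ 2 = 1 := by
      refine Eq.trans ?_ hdoc
      rw [show k + 1 + 1 = k + 2 from rfl, hnext, ← h]
      field_simp
      ring
    nlinarith
  rw [show k + 1 + 1 = k + 2 from rfl, hnext, ← h]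
  have hone' : W = (1 + r ^ 2) / (r * (1 - r)) := by
    have : 1 - r ≠ 0 := by linarith
    field_simp at hone ⊢
    linarith
  have h1r : 1 - r ≠ 0 := by linarith
  rw [hone']
  constructor <;> ext <;> simp [Ppt, Ppt', s, t] <;> field_simp <;> ring

/-- For every integer `K ≥ 3` there is a parameter
`θ ∈ (0, π/4)` such that for `F = F_θ` and every `N ≥ 0` there is a point
`X ∈ [E₁,P₄]`, `X ≠ E₁`, with `Fⁿ(X) ∈ ℬ₁` for `0 ≤ n < K`, `F^K(X) ∈ [E₁,P₁]`,
`Fⁿ(X) ∈ 𝒜₁` for `K ≤ n < K+N`, and `F^{K+N}(X) = R(X)`; in particular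
`F^{4(K+N)}(X) = X`. -/
theorem exists_periodic_cancellation_orbit (K : ℕ) (hK : 3 ≤ K) :
    ∃ θ ∈ Ioo 0 (π/4), ∀ F : Pt → Pt, IsPAMap (sof θ) (tof θ) F →
      ∀ N : ℕ, ∃ X ∈ segment ℝ (Ept 0) (Ppt (sof θ) (tof θ) 3),
        X ≠ Ept 0 ∧
        (∀ n < K, F^[n] X ∈ Bpiece (sof θ) (tof θ) 0) ∧
        F^[K] X ∈ segment ℝ (Ept 0) (Ppt (sof θ) (tof θ) 0) ∧
        (∀ n, K ≤ n → n < K + N → F^[n] X ∈ Apiece (sof θ) (tof θ) 0) ∧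
        F^[K + N] X = Rmap X ∧
        F^[4*(K + N)] X = X := by
  obtain ⟨r, hr, hrK⟩ := exists_slope_lucasSeq hK
  have hr₀ := hr.1
  have hr₁ := hr.2
  have hT : 2 ≤ traceB r := by
    have : 0 < 1 - r := by linarith
    have : 0 ≤ (1 - r) ^ 3 / (r * (1 + r ^ 2)) := by positivity
    rw [traceB]
    linarith
  refine ⟨arctan r, ⟨arctan_pos.2 hr₀, arctan_one ▸ arctan_strictMono hr₁⟩, fun F hF N => ?_⟩
  obtain ⟨h₁, h₄⟩ := lucasSeq_smul_Ppt' hr (by omega) hT hrK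
  rw [sof_arctan, tof_arctan] at hF ⊢
  set s := r / (1 + r ^ 2)
  set t := r ^ 2 / (1 + r ^ 2)
  have hs : 2 * s ≤ 1 := by
    simp only [s]
    rw [← mul_div_assoc, div_le_one (by positivity)]
    nlinarith [sq_nonneg (1 - r)]
  have ht₀ : 0 < t := by positivity
  have hc : 0 ≤ 1 - 2 * s := by linarith
  set l := 1 / (1 + N * (1 - 2 * s)) with hl
  have hl₀ : 0 < l := by positivity
  have hlN : N * (1 - 2 * s) * l + l = 1 := by
    rw [hl]
    field_simp
    ring
  have hl₁ : l ≤ 1 := by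
    have : 0 ≤ N * (1 - 2 * s) * l := by positivity
    linarith
  have hB := fun n (hn : n ≤ K) => hF.iterate_B hT (by omega) h₁ h₄ hl₀.le hl₁ hn
  have hFK : F^[K] (l • Ppt s t 3) = l • Ppt s t 0 := by
    have hw := lucasSeq_succ_pos hT (K - 1)
    rw [Nat.sub_add_cancel (by omega)] at hw
    rw [(hB K le_rfl).2, div_mul_cancel₀ _ hw.ne']
    simp [lucasSeq]
  have hA := fun m (hm : m ≤ N) => hF.iterate_A hs hl₀.le hlN.le hm
  have hseg : ∀ p : Pt, l • p ∈ segment ℝ (Ept 0) p := fun p =>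
    ⟨1 - l, l, by linarith, hl₀.le, by ring, by
      rw [show Ept 0 = 0 from rfl, smul_zero, zero_add]⟩
  have hend : F^[K + N] (l • Ppt s t 3) = Rmap (l • Ppt s t 3) := by
    rw [add_comm, Function.iterate_add_apply, hFK, (hA N le_rfl).2]
    ext
    · simp [Ept, Ppt, Rmap]
      linear_combination hlN
    · simp [Ept, Ppt, Rmap]
  have hAn : ∀ n, K ≤ n → n < K + N → F^[n] (l • Ppt s t 3) ∈ Apiece s t 0 := by
    intro n hn hnN
    obtain ⟨m, rfl⟩ := Nat.exists_eq_add_of_le' hn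
    rw [Function.iterate_add_apply, hFK, (hA m (by omega)).2]
    exact (hA m (by omega)).1
  refine ⟨l • Ppt s t 3, hseg _, fun h => ?_, fun n hn => (hB n hn.le).1, hFK ▸ hseg _, hAn, hend,
    hF.iterate_four_mul (i := 0) (fun n hn => ?_) hend⟩
  · have := congrArg Prod.fst h
    simp [Ept, Ppt, hl₀.ne', ht₀.ne'] at this
  · rcases lt_or_ge n K with hnK | hnK
    · exact Or.inr (hB n hnK.le).1
    · exact Or.inl (hAn n hnK hn)
end
end
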